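/- arXiv:1605.03520 — 4 statements merged into one kernel-verified Lean document; each statement's English description precedes it below -/
import Mathlib

section
/- Let Ω ⊆ ℝ^d be open, δ₀ > 0, and let a₁, b₁, a₂, b₂, Γ : Ω → ℝ be continuous functions such that: (h1) a₁(y)² + b₁(y)² > 0 for all y ∈ Ω; (h2) 4(a₂(y)² + b₂(y)²) = δ₀² for all y ∈ Ω; (h3) a₁(y)a₂(y) + b₁(y)b₂(y) = y₁·Γ(y) for all y ∈ Ω. For δ ∈ ℝ define the gap g(y,δ) = 2√((y₁a₁(y) + (δ/δ₀)a₂(y))² + (y₁b₁(y) + (δ/δ₀)b₂(y))²). Assume the avoided-crossing hypothesis at δ = δ₀: for every y ∈ Ω one has g(y,δ₀) ≥ δ₀, with equality if and only if y₁ = 0. Then for every δ ∈ [0, δ₀] and every y ∈ Ω: (i) g(y,δ)² = 4y₁²·(a₁(y)² + b₁(y)² + 2(δ/δ₀)Γ(y)) + δ²; (ii) g(y,δ) ≥ δ, with equality if and only if y₁ = 0; (iii) g(y,δ) = 0 if and only if y₁ = 0 and δ = 0. -/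
/-- Quantitative core of Theorem 3.1 of the paper: in local
coordinates `y = (y₁, y′)` with minimal gap hypersurface `{y₁ = 0}`, the
interpolated gap `g(y,δ)` of the family `V₀(y,δ) = y₁V₁(y) + (δ/δ₀)V₂(y′)`
satisfies, for all `δ ∈ [0, δ₀]` and `y ∈ Ω`:
(i) `g(y,δ)² = 4y₁²(a₁² + b₁² + 2(δ/δ₀)Γ) + δ²`;
(ii) `g(y,δ) ≥ δ` with equality iff `y₁ = 0`;
(iii) `g(y,δ) = 0` iff `y₁ = 0` and `δ = 0`. -/
theorem stmt2 {d : ℕ} (hd : 1 ≤ d) (Ω : Set (Fin d → ℝ)) (hΩ : IsOpen Ω)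
    (δ₀ : ℝ) (hδ₀ : 0 < δ₀)
    (a₁ b₁ a₂ b₂ Γ : (Fin d → ℝ) → ℝ)
    (ha₁ : ContinuousOn a₁ Ω) (hb₁ : ContinuousOn b₁ Ω)
    (ha₂ : ContinuousOn a₂ Ω) (hb₂ : ContinuousOn b₂ Ω)
    (hΓ : ContinuousOn Γ Ω)
    (h1 : ∀ y ∈ Ω, 0 < a₁ y ^ 2 + b₁ y ^ 2)
    (h2 : ∀ y ∈ Ω, 4 * (a₂ y ^ 2 + b₂ y ^ 2) = δ₀ ^ 2)
    (h3 : ∀ y ∈ Ω, a₁ y * a₂ y + b₁ y * b₂ y = y ⟨0, hd⟩ * Γ y)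
    (g : (Fin d → ℝ) → ℝ → ℝ)
    (hg : ∀ y δ, g y δ =
      2 * Real.sqrt ((y ⟨0, hd⟩ * a₁ y + (δ / δ₀) * a₂ y) ^ 2 +
        (y ⟨0, hd⟩ * b₁ y + (δ / δ₀) * b₂ y) ^ 2))
    (hcross : ∀ y ∈ Ω, δ₀ ≤ g y δ₀ ∧ (g y δ₀ = δ₀ ↔ y ⟨0, hd⟩ = 0)) :
    ∀ δ ∈ Set.Icc (0 : ℝ) δ₀, ∀ y ∈ Ω,
      (g y δ) ^ 2 =
        4 * (y ⟨0, hd⟩) ^ 2 * (a₁ y ^ 2 + b₁ y ^ 2 + 2 * (δ / δ₀) * Γ y) + δ ^ 2 ∧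
      (δ ≤ g y δ ∧ (g y δ = δ ↔ y ⟨0, hd⟩ = 0)) ∧
      (g y δ = 0 ↔ (y ⟨0, hd⟩ = 0 ∧ δ = 0)) := by
  intro δ hδ y hy
  have hg_nonneg : ∀ ε, 0 ≤ g y ε := fun ε => by rw [hg]; positivity
  have hsq : ∀ ε, (g y ε) ^ 2 =
      4 * (y ⟨0, hd⟩) ^ 2 * (a₁ y ^ 2 + b₁ y ^ 2 + 2 * (ε / δ₀) * Γ y) + ε ^ 2 := by
    intro ε
    have hε : ε ^ 2 = (ε / δ₀) ^ 2 * δ₀ ^ 2 := by field_simp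
    rw [hg, mul_pow, Real.sq_sqrt (by positivity), hε]
    linear_combination (ε / δ₀) ^ 2 * h2 y hy + 8 * y ⟨0, hd⟩ * (ε / δ₀) * h3 y hy
  have ht0 : 0 ≤ δ / δ₀ := div_nonneg hδ.1 hδ₀.le
  have ht1 : δ / δ₀ ≤ 1 := (div_le_one hδ₀).2 hδ.2
  have heq : y ⟨0, hd⟩ = 0 → g y δ = δ := by
    intro h0
    have h := hsq δ
    rw [h0] at h
    exact (sq_eq_sq₀ (hg_nonneg δ) hδ.1).1 (by linarith)
  have hlt : y ⟨0, hd⟩ ≠ 0 → δ < g y δ := by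
    intro h0
    have hy2 : 0 < 4 * (y ⟨0, hd⟩) ^ 2 := by positivity
    have hstrict : δ₀ < g y δ₀ :=
      lt_of_le_of_ne (hcross y hy).1 fun h => h0 ((hcross y hy).2.1 h.symm)
    have hcoef₀ : 0 < a₁ y ^ 2 + b₁ y ^ 2 + 2 * Γ y := by
      have h := hsq δ₀
      rw [div_self hδ₀.ne', mul_one] at h
      have hlt_sq := pow_lt_pow_left₀ hstrict hδ₀.le two_ne_zero
      exact pos_of_mul_pos_right (by linarith) hy2.le
    have hcoef : 0 < a₁ y ^ 2 + b₁ y ^ 2 + 2 * (δ / δ₀) * Γ y := by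
      have hA := h1 y hy
      rcases ht1.lt_or_eq with ht | ht
      · nlinarith [mul_pos (sub_pos.2 ht) hA, mul_nonneg ht0 hcoef₀.le]
      · rw [ht]; linarith
    refine lt_of_pow_lt_pow_left₀ 2 (hg_nonneg δ) ?_
    rw [hsq δ]
    linarith [mul_pos hy2 hcoef]
  have hle : δ ≤ g y δ := by
    by_cases h0 : y ⟨0, hd⟩ = 0
    · exact (heq h0).ge
    · exact (hlt h0).le
  have hiff : g y δ = δ ↔ y ⟨0, hd⟩ = 0 :=
    ⟨fun h => by_contra fun h0 => (hlt h0).ne' h, heq⟩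
  refine ⟨hsq δ, ⟨hle, hiff⟩, fun h => ?_, fun h => (heq h.1).trans h.2⟩
  have hδ0 : δ = 0 := le_antisymm (h ▸ hle) hδ.1
  exact ⟨hiff.1 (h.trans hδ0.symm), hδ0⟩
end

section
/- Let a₁, b₁, a₂, b₂, y₁, t be real numbers with ρ := √(a₁² + b₁²) > 0. Set β = y₁a₁ + t·a₂ and γ = y₁b₁ + t·b₂, and let θ ∈ ℝ satisfy cos(2θ) = a₁/ρ and sin(2θ) = −b₁/ρ. Then, with the rotation matrix R(θ) = [[cos θ, −sin θ],[sin θ, cos θ]], one has R(θ)·[[β, γ],[γ, −β]]·R(θ)ᵀ = [[β̃, γ̂],[γ̂, −β̃]], where β̃ = y₁ρ + t·(a₁a₂ + b₁b₂)/ρ and γ̂ = t·(a₁b₂ − a₂b₁)/ρ. In particular, the off-diagonal entry of the rotated matrix is proportional to t and contains no contribution linear in y₁ multiplied by nonzero constants, i.e. it is independent of y₁. -/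
/-- Conjugating a symmetric trace-free matrix by the rotation of angle `θ` rotates its entries by
the angle `2 * θ`. -/
theorem rotation_mul_traceFree_mul_transpose (θ β γ : ℝ) :
    !![Real.cos θ, -Real.sin θ; Real.sin θ, Real.cos θ] * !![β, γ; γ, -β] *
        (!![Real.cos θ, -Real.sin θ; Real.sin θ, Real.cos θ] : Matrix (Fin 2) (Fin 2) ℝ).transpose =
      !![Real.cos (2 * θ) * β - Real.sin (2 * θ) * γ, Real.sin (2 * θ) * β + Real.cos (2 * θ) * γ;
         Real.sin (2 * θ) * β + Real.cos (2 * θ) * γ,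
         -(Real.cos (2 * θ) * β - Real.sin (2 * θ) * γ)] := by
  rw [Real.cos_two_mul', Real.sin_two_mul]
  ext i j
  fin_cases i <;> fin_cases j <;> simp [Matrix.mul_apply, Fin.sum_univ_two] <;> ring

/-- Pointwise content of Theorem 3.1, claim (3): with
`ρ = √(a₁² + b₁²) > 0`, `β = y₁a₁ + t·a₂`, `γ = y₁b₁ + t·b₂` and the rotation
angle `θ` satisfying `cos(2θ) = a₁/ρ`, `sin(2θ) = −b₁/ρ`, the rotated matrix
`R(θ)·[[β, γ],[γ, −β]]·R(θ)ᵀ` equals `[[β̃, γ̂],[γ̂, −β̃]]` with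
`β̃ = y₁ρ + t(a₁a₂ + b₁b₂)/ρ` and `γ̂ = t(a₁b₂ − a₂b₁)/ρ`; in particular
the off-diagonal entry is proportional to `t` and independent of `y₁`. -/
theorem stmt3 (a₁ b₁ a₂ b₂ y₁ t θ : ℝ)
    (ρ : ℝ) (hρ : ρ = Real.sqrt (a₁ ^ 2 + b₁ ^ 2)) (hρpos : 0 < ρ)
    (β γ : ℝ) (hβ : β = y₁ * a₁ + t * a₂) (hγ : γ = y₁ * b₁ + t * b₂)
    (hcos : Real.cos (2 * θ) = a₁ / ρ) (hsin : Real.sin (2 * θ) = -b₁ / ρ)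
    (R : Matrix (Fin 2) (Fin 2) ℝ)
    (hR : R = !![Real.cos θ, -Real.sin θ; Real.sin θ, Real.cos θ]) :
    R * !![β, γ; γ, -β] * R.transpose =
      !![y₁ * ρ + t * (a₁ * a₂ + b₁ * b₂) / ρ, t * (a₁ * b₂ - a₂ * b₁) / ρ;
         t * (a₁ * b₂ - a₂ * b₁) / ρ, -(y₁ * ρ + t * (a₁ * a₂ + b₁ * b₂) / ρ)] := by
  have hsq : ρ ^ 2 = a₁ ^ 2 + b₁ ^ 2 := by
    rw [hρ, Real.sq_sqrt (by positivity)]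
  have hdiag : a₁ / ρ * β - -b₁ / ρ * γ = y₁ * ρ + t * (a₁ * a₂ + b₁ * b₂) / ρ := by
    rw [hβ, hγ]
    field_simp
    rw [hsq]
    ring
  have hoff : -b₁ / ρ * β + a₁ / ρ * γ = t * (a₁ * b₂ - a₂ * b₁) / ρ := by
    rw [hβ, hγ]
    ring
  rw [hR, rotation_mul_traceFree_mul_transpose, hcos, hsin, hdiag, hoff]
end

section
/- Let Π : ℝ → Matrix (Fin 2) (Fin 2) ℝ be differentiable with Π(t)·Π(t) = Π(t) for all t, set Q(t) = 1 − Π(t), and let c : ℝ → ℝ be differentiable and g : ℝ → ℝ be differentiable with g(t) ≠ 0 for all t. Define B₀(t) = c(t)·Π′(t) and B(t) = (1/g(t))·(Q(t)·B₀(t)·Π(t) − Π(t)·B₀(t)·Q(t)). Then for every t the diagonal blocks of the derivative of B vanish: Π(t)·B′(t)·Π(t) = 0 and Q(t)·B′(t)·Q(t) = 0; in other words, B′(t) is again off-diagonal with respect to Π(t). -/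
/-- The product rule for matrix-valued functions with entrywise derivatives. -/
theorem hasDerivAt_matrix_mul_apply {l m n : Type*} [Fintype m]
    {A : ℝ → Matrix l m ℝ} {A' : Matrix l m ℝ} {C : ℝ → Matrix m n ℝ} {C' : Matrix m n ℝ} {t : ℝ}
    (hA : ∀ i j, HasDerivAt (fun s => A s i j) (A' i j) t)
    (hC : ∀ i j, HasDerivAt (fun s => C s i j) (C' i j) t) (i : l) (j : n) :
    HasDerivAt (fun s => (A s * C s) i j) ((A' * C t + A t * C') i j) t := by
  simp only [Matrix.mul_apply, Matrix.add_apply, ← Finset.sum_add_distrib]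
  exact HasDerivAt.fun_sum fun k _ => (hA i k).mul (hC k j)

/-- If `D = D p + p D`, then `D` anticommutes with the commutator `D p - p D`. -/
theorem mul_commutator_add_commutator_mul_eq_zero {R : Type*} [Ring R] {p D : R}
    (hD : D = D * p + p * D) : D * (D * p - p * D) + (D * p - p * D) * D = 0 := by
  have h₁ : D * D = D * D * p + D * p * D := by
    conv_lhs => arg 2; rw [hD]
    noncomm_ring
  have h₂ : D * D = D * p * D + p * D * D := by
    conv_lhs => arg 1; rw [hD]
    noncomm_ring
  have h₃ : D * D * p = p * D * D := by
    rw [add_comm] at h₁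
    exact add_left_cancel (h₁.symm.trans h₂)
  calc D * (D * p - p * D) + (D * p - p * D) * D = D * D * p - p * D * D := by noncomm_ring
    _ = 0 := sub_eq_zero.mpr h₃

/-- If `p` is idempotent and `x = p x + x p`, both diagonal blocks of `x` vanish. -/
theorem IsIdempotentElem.diagonal_blocks_eq_zero {R : Type*} [Ring R] {p x : R}
    (hp : IsIdempotentElem p) (hx : x = p * x + x * p) :
    p * x * p = 0 ∧ (1 - p) * x * (1 - p) = 0 := by
  have h₁ : p * x * p = 0 := by
    have h : p * x = p * x + p * x * p := by
      conv_lhs => rw [hx]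
      rw [mul_add, ← mul_assoc, ← mul_assoc, hp.eq]
    exact left_eq_add.mp h
  refine ⟨h₁, ?_⟩
  calc (1 - p) * x * (1 - p) = x - (p * x + x * p) + p * x * p := by noncomm_ring
    _ = 0 := by rw [← hx, h₁, sub_self, add_zero]

/-- Let `Π : ℝ → Matrix (Fin 2) (Fin 2) ℝ` be differentiable
(with entrywise derivative `Π'`) and idempotent, `Q = 1 − Π`, let `c` be
differentiable and `g` differentiable and nonvanishing. With
`B₀ = c·Π'` and `B = g⁻¹·(Q B₀ Π − Π B₀ Q)`, the derivative `B'` of `B`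
has vanishing diagonal blocks: `Π B' Π = 0` and `Q B' Q = 0`; i.e. `B'` is
again off-diagonal with respect to `Π`. -/
theorem stmt6 (P P' : ℝ → Matrix (Fin 2) (Fin 2) ℝ)
    (hP : ∀ i j t, HasDerivAt (fun s => P s i j) (P' t i j) t)
    (hidem : ∀ t, P t * P t = P t)
    (Q : ℝ → Matrix (Fin 2) (Fin 2) ℝ) (hQ : ∀ t, Q t = 1 - P t)
    (c g : ℝ → ℝ) (hc : Differentiable ℝ c) (hg : Differentiable ℝ g)
    (hg0 : ∀ t, g t ≠ 0)
    (B₀ : ℝ → Matrix (Fin 2) (Fin 2) ℝ) (hB₀ : ∀ t, B₀ t = c t • P' t)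
    (B : ℝ → Matrix (Fin 2) (Fin 2) ℝ)
    (hB : ∀ t, B t = (g t)⁻¹ • (Q t * B₀ t * P t - P t * B₀ t * Q t))
    (t : ℝ) (B' : Matrix (Fin 2) (Fin 2) ℝ)
    (hB' : ∀ i j, HasDerivAt (fun s => B s i j) (B' i j) t) :
    P t * B' * P t = 0 ∧ Q t * B' * Q t = 0 := by
  have hD : ∀ s, P' s = P' s * P s + P s * P' s := fun s => by
    ext i j
    have h := hasDerivAt_matrix_mul_apply (fun i j => hP i j s) (fun i j => hP i j s) i j
    simp only [hidem] at h
    exact (hP i j s).unique h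
  have hBcomm : ∀ s, B s = ((g s)⁻¹ * c s) • (P' s * P s - P s * P' s) := fun s => by
    rw [hB, hB₀, hQ, mul_smul]
    simp only [mul_smul_comm, smul_mul_assoc, ← smul_sub]
    congr 2
    noncomm_ring
  have hBsplit : ∀ s, B s = P s * B s + B s * P s := fun s => by
    rw [hBcomm, mul_smul_comm, smul_mul_assoc, ← smul_add]
    congr 1
    simp only [mul_sub, sub_mul, ← mul_assoc, hidem]
    rw [mul_assoc (P' s), hidem]
    abel
  have hanti : P' t * B t + B t * P' t = 0 := by
    rw [hBcomm, mul_smul_comm, smul_mul_assoc, ← smul_add,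
      mul_commutator_add_commutator_mul_eq_zero (hD t), smul_zero]
  have hB'split : B' = P t * B' + B' * P t := by
    have h : B' = (P' t * B t + P t * B') + (B' * P t + B t * P' t) := by
      ext i j
      have h := (hasDerivAt_matrix_mul_apply (fun i j => hP i j t) hB' i j).add
        (hasDerivAt_matrix_mul_apply hB' (fun i j => hP i j t) i j)
      refine (hB' i j).unique (h.congr_of_eventuallyEq (.of_forall fun s => ?_))
      exact congrFun (congrFun (hBsplit s) i) j
    calc B' = (P' t * B t + P t * B') + (B' * P t + B t * P' t) := h
      _ = (P' t * B t + B t * P' t) + (P t * B' + B' * P t) := by abel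
      _ = P t * B' + B' * P t := by rw [hanti, zero_add]
  rw [hQ]
  exact IsIdempotentElem.diagonal_blocks_eq_zero (hidem t) hB'split
end

section
/- Let s, c ∈ ℝ with s ≠ 0, put r = √(s² + c²) and Π⁺ = (1/2)·(Id − r⁻¹·[[s, c],[c, −s]]). If s > 0, then every entry of the matrix Π⁺ − [[0, 0],[0, 1]] has absolute value at most |c|/|s|; if s < 0, then every entry of Π⁺ − [[1, 0],[0, 0]] has absolute value at most |c|/|s|. -/
/-- If `|s| ≤ r ≤ |s| + |c|`, the diagonal deviation `(1 - |s| / r) / 2` is at most `|c| / |s|`. -/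
lemma abs_half_one_sub_inv_mul_abs_le {s c r : ℝ} (hs : s ≠ 0) (h₁ : |s| ≤ r)
    (h₂ : r ≤ |s| + |c|) : |1 / 2 * (1 - r⁻¹ * |s|)| ≤ |c| / |s| := by
  have hs' : 0 < |s| := abs_pos.mpr hs
  have hr : 0 < r := hs'.trans_le h₁
  have heq : 1 - r⁻¹ * |s| = (r - |s|) / r := by field_simp
  have hnn : 0 ≤ (r - |s|) / r := div_nonneg (sub_nonneg.mpr h₁) hr.le
  have hle : (r - |s|) / r ≤ |c| / |s| :=
    div_le_div₀ (abs_nonneg c) (by linarith) hs' h₁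
  rw [heq, abs_of_nonneg (by positivity)]
  linarith

/-- If `|s| ≤ r`, the off-diagonal entry `c / (2 r)` is at most `|c| / |s|` in absolute value. -/
lemma abs_half_inv_mul_le {s c r : ℝ} (hs : s ≠ 0) (h₁ : |s| ≤ r) :
    |1 / 2 * (r⁻¹ * c)| ≤ |c| / |s| := by
  have hs' : 0 < |s| := abs_pos.mpr hs
  have hr : 0 < r := hs'.trans_le h₁
  have hle : |c| / r ≤ |c| / |s| := div_le_div_of_nonneg_left (abs_nonneg c) hs' h₁
  have hnn : 0 ≤ |c| / r := by positivity
  have heq : |1 / 2 * (r⁻¹ * c)| = 1 / 2 * (|c| / r) := by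
    rw [abs_mul, abs_mul, abs_of_pos (inv_pos.mpr hr), abs_of_pos (by norm_num : (0 : ℝ) < 1 / 2)]
    ring
  rw [heq]
  linarith

/-- For `s ≠ 0`, `r = √(s² + c²)` and
`Π⁺ = (1/2)(Id − r⁻¹[[s, c],[c, −s]])`: if `s > 0` then every entry of
`Π⁺ − [[0,0],[0,1]]` has absolute value at most `|c|/|s|`, and if `s < 0`
then every entry of `Π⁺ − [[1,0],[0,0]]` has absolute value at most
`|c|/|s|`. -/
theorem stmt8 (s c : ℝ) (hs : s ≠ 0)
    (r : ℝ) (hr : r = Real.sqrt (s ^ 2 + c ^ 2))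
    (Pp : Matrix (Fin 2) (Fin 2) ℝ)
    (hPp : Pp = (1 / 2 : ℝ) •
      ((1 : Matrix (Fin 2) (Fin 2) ℝ) - r⁻¹ • !![s, c; c, -s])) :
    (0 < s → ∀ i j : Fin 2,
      |(Pp - !![0, 0; 0, 1] : Matrix (Fin 2) (Fin 2) ℝ) i j| ≤ |c| / |s|) ∧
    (s < 0 → ∀ i j : Fin 2,
      |(Pp - !![1, 0; 0, 0] : Matrix (Fin 2) (Fin 2) ℝ) i j| ≤ |c| / |s|) := by
  have h₁ : |s| ≤ r := by
    rw [hr]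
    exact Real.abs_le_sqrt (by nlinarith [sq_nonneg c])
  have h₂ : r ≤ |s| + |c| := by
    rw [hr, Real.sqrt_le_left (by positivity)]
    nlinarith [sq_abs s, sq_abs c, mul_nonneg (abs_nonneg s) (abs_nonneg c)]
  have hd := abs_half_one_sub_inv_mul_abs_le hs h₁ h₂
  have ho := abs_half_inv_mul_le (c := c) hs h₁
  have hd' : |-(1 / 2 * (1 - r⁻¹ * |s|))| ≤ |c| / |s| := by rwa [abs_neg]
  have ho' : |-(1 / 2 * (r⁻¹ * c))| ≤ |c| / |s| := by rwa [abs_neg]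
  subst hPp
  constructor
  · intro hpos i j
    have habs := abs_of_pos hpos
    fin_cases i <;> fin_cases j
    · convert hd using 2
      simp [habs]
    · convert ho' using 2
      simp
    · convert ho' using 2
      simp
    · convert hd' using 2
      simp [habs]
      ring
  · intro hneg i j
    have habs := abs_of_neg hneg
    fin_cases i <;> fin_cases j
    · convert hd' using 2
      simp [habs]
      ring
    · convert ho' using 2
      simp
    · convert ho' using 2
      simp
    · convert hd using 2
      simp [habs]
end
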